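/- arXiv:2510.13225 — 3 statements merged into one kernel-verified Lean document; each statement's English description precedes it below -/
import Mathlib

section
/- Let C be a skeletally small triangulated category and let D be a dense triangulated subcategory of C. Define √D = { U ∈ C | the direct sum U^n of n copies of U lies in D for some n ≥ 1 }. Then: (1) D ⊆ √D; (2) √(√D) = √D; (3) √D is a radical dense subcategory of C (in particular it is a triangulated subcategory of C); (4) D is a radical dense subcategory of C if and only if √D = D. -/
open CategoryTheory CategoryTheory.Limits CategoryTheory.Pretriangulated
open scoped TensorProduct

universe v u

set_option linter.unusedSectionVars false
set_option linter.unusedVariables false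

namespace GrothendieckPaper

variable (C : Type u) [Category.{v} C] [Preadditive C] [Limits.HasZeroObject C]
  [HasShift C ℤ] [∀ n : ℤ, (shiftFunctor C n).Additive] [Pretriangulated C]

/-- The set of Euler relations `[V] - [U] - [W]` coming from distinguished triangles
`U ⟶ V ⟶ W ⟶ U⟦1⟧`. -/
def eulerSet : Set (FreeAbelianGroup C) :=
  { x | ∃ T : Triangle C, (T ∈ distTriang C) ∧
      x = FreeAbelianGroup.of T.obj₂ - FreeAbelianGroup.of T.obj₁ - FreeAbelianGroup.of T.obj₃ }

def eulerSubgroup : AddSubgroup (FreeAbelianGroup C) := AddSubgroup.closure (eulerSet C)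

/-- The Grothendieck group of a (skeletally small) triangulated category. -/
def G : Type u := FreeAbelianGroup C ⧸ eulerSubgroup C

instance : AddCommGroup (G C) := QuotientAddGroup.Quotient.addCommGroup _

/-- The class `[U]` of an object `U` in the Grothendieck group. -/
def cls (U : C) : G C := QuotientAddGroup.mk (FreeAbelianGroup.of U)

/-- A (strictly full) triangulated subcategory of `C`, given by its set of objects:
closed under isomorphisms, under the shifts `[1]` and `[-1]`, and under extensions
(cones): if `X ⟶ Y ⟶ Z ⟶ X⟦1⟧` is distinguished and `X, Y` belong then so does `Z`. -/
structure IsTriangulatedSubcat (S : Set C) : Prop where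
  mem_of_iso : ∀ {X Y : C}, (X ≅ Y) → Y ∈ S → X ∈ S
  shift_mem : ∀ {X : C}, X ∈ S → ((shiftFunctor C (1 : ℤ)).obj X) ∈ S
  shift_neg_mem : ∀ {X : C}, X ∈ S → ((shiftFunctor C (-1 : ℤ)).obj X) ∈ S
  ext_mem : ∀ (T : Triangle C), (T ∈ distTriang C) → T.obj₁ ∈ S → T.obj₂ ∈ S → T.obj₃ ∈ S

/-- `npowAux U n` is the direct sum of `n + 1` copies of `U`. -/
noncomputable def npowAux (U : C) : ℕ → C
  | 0 => U
  | n + 1 => U ⊞ npowAux U n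

/-- `npow U n` is the direct sum `U^n` of `n` copies of `U` (for `n ≥ 1`;
`npow U 0` is defined to be `U` as a junk value). -/
noncomputable def npow (U : C) (n : ℕ) : C := npowAux C U (n - 1)

/-- A subcategory (set of objects) `S` is dense in `C` if every object of `C` is a
direct summand of an object of `S`. -/
def DenseSub (S : Set C) : Prop := ∀ U : C, ∃ V : C, (U ⊞ V) ∈ S

/-- A subcategory `S` is radical if `U^n ∈ S` for some `n ≥ 1` implies `U ∈ S`. -/
def RadicalSub (S : Set C) : Prop := ∀ (U : C) (n : ℕ), 1 ≤ n → npow C U n ∈ S → U ∈ S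

/-- `√S = { U | U^n ∈ S for some n ≥ 1 }`. -/
def sqrtSet (S : Set C) : Set C := { U : C | ∃ n : ℕ, 1 ≤ n ∧ npow C U n ∈ S }

lemma subset_sqrtSet (S : Set C) : S ⊆ sqrtSet C S := fun U hU => ⟨1, le_refl 1, hU⟩

/-- The Euler relations for the full subcategory on `S`, coming from distinguished
triangles of `C` all of whose vertices lie in `S`. -/
def eulerSetSub (S : Set C) : Set (FreeAbelianGroup S) :=
  { x | ∃ (T : Triangle C) (_ : T ∈ distTriang C) (h1 : T.obj₁ ∈ S) (h2 : T.obj₂ ∈ S)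
      (h3 : T.obj₃ ∈ S),
      x = FreeAbelianGroup.of (⟨T.obj₂, h2⟩ : S) - FreeAbelianGroup.of ⟨T.obj₁, h1⟩
        - FreeAbelianGroup.of ⟨T.obj₃, h3⟩ }

/-- The Grothendieck group of the triangulated subcategory on the set of objects `S`. -/
def GSub (S : Set C) : Type u := FreeAbelianGroup S ⧸ AddSubgroup.closure (eulerSetSub C S)

instance (S : Set C) : AddCommGroup (GSub C S) := QuotientAddGroup.Quotient.addCommGroup _

lemma delta_le (S : Set C) :
    AddSubgroup.closure (eulerSetSub C S) ≤
      (eulerSubgroup C).comap (FreeAbelianGroup.map (Subtype.val : S → C)) := by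
  rw [AddSubgroup.closure_le]
  rintro x ⟨T, hT, h1, h2, h3, rfl⟩
  simp only [SetLike.mem_coe, AddSubgroup.mem_comap, map_sub, FreeAbelianGroup.map_of_apply]
  exact AddSubgroup.subset_closure ⟨T, hT, rfl⟩

/-- The natural map `δ^S : G(S) → G(C)` induced by the inclusion of the subcategory. -/
def deltaHom (S : Set C) : GSub C S →+ G C :=
  QuotientAddGroup.map _ _ (FreeAbelianGroup.map (Subtype.val : S → C)) (delta_le C S)

lemma incl_le {S S' : Set C} (h : S ⊆ S') :
    AddSubgroup.closure (eulerSetSub C S) ≤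
      (AddSubgroup.closure (eulerSetSub C S')).comap
        (FreeAbelianGroup.map (Set.inclusion h)) := by
  rw [AddSubgroup.closure_le]
  rintro x ⟨T, hT, h1, h2, h3, rfl⟩
  simp only [SetLike.mem_coe, AddSubgroup.mem_comap, map_sub, FreeAbelianGroup.map_of_apply]
  exact AddSubgroup.subset_closure ⟨T, hT, h h1, h h2, h h3, rfl⟩

/-- The map `G(S) → G(S')` induced by an inclusion `S ⊆ S'` of subcategories. -/
def inclHom {S S' : Set C} (h : S ⊆ S') : GSub C S →+ GSub C S' :=
  QuotientAddGroup.map _ _ (FreeAbelianGroup.map (Set.inclusion h)) (incl_le C h)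

/-- `δ^S ⊗ ℚ : G(S)_ℚ → G(C)_ℚ`. -/
noncomputable def deltaQ (S : Set C) : ℚ ⊗[ℤ] GSub C S →ₗ[ℚ] ℚ ⊗[ℤ] G C :=
  LinearMap.baseChange ℚ (deltaHom C S).toIntLinearMap

/-- The rationalization of the map induced by an inclusion of subcategories. -/
noncomputable def inclQ {S S' : Set C} (h : S ⊆ S') :
    ℚ ⊗[ℤ] GSub C S →ₗ[ℚ] ℚ ⊗[ℤ] GSub C S' :=
  LinearMap.baseChange ℚ (inclHom C h).toIntLinearMap

/-- The collection `I(H)` of dense triangulated subcategories `S` of `C` with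
`image(δ^S_ℚ) = H`. -/
def denseFamily (H : Submodule ℚ (ℚ ⊗[ℤ] G C)) : Set (Set C) :=
  { S | IsTriangulatedSubcat C S ∧ DenseSub C S ∧ LinearMap.range (deltaQ C S) = H }


variable {C}

/-- Isomorphic objects have isomorphic powers. -/
noncomputable def npowAuxCongr {U V : C} (e : U ≅ V) : ∀ n : ℕ, npowAux C U n ≅ npowAux C V n
  | 0 => e
  | n + 1 => biprod.mapIso e (npowAuxCongr e n)

/-- An additive functor commutes with powers. -/
noncomputable def npowAuxMap (F : C ⥤ C) [F.Additive] (U : C) :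
    ∀ n : ℕ, npowAux C (F.obj U) n ≅ F.obj (npowAux C U n)
  | 0 => Iso.refl _
  | n + 1 =>
    have := preservesBinaryBiproducts_of_preservesBiproducts F
    biprod.mapIso (Iso.refl _) (npowAuxMap F U n) ≪≫ (F.mapBiprod U (npowAux C U n)).symm

/-- `U^(a + b) ≅ U^a ⊞ U^b`. -/
noncomputable def npowAuxAdd (U : C) (b : ℕ) :
    ∀ a : ℕ, npowAux C U (a + 1 + b) ≅ npowAux C U a ⊞ npowAux C U b
  | 0 => eqToIso (by rw [show 0 + 1 + b = b + 1 by omega]; rfl)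
  | a + 1 => eqToIso (by rw [show a + 1 + 1 + b = (a + 1 + b) + 1 by omega]; rfl) ≪≫
      biprod.mapIso (Iso.refl U) (npowAuxAdd U b a) ≪≫
      (biprod.associator U (npowAux C U a) (npowAux C U b)).symm

/-- `U^(a * b) ≅ (U^a)^b`. -/
noncomputable def npowAuxMul (U : C) (a : ℕ) :
    ∀ b : ℕ, npowAux C U ((a + 1) * (b + 1) - 1) ≅ npowAux C (npowAux C U a) b
  | 0 => eqToIso (by rw [show (a + 1) * (0 + 1) - 1 = a by omega]; rfl)
  | b + 1 => eqToIso (by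
        rw [show (a + 1) * (b + 1 + 1) - 1 = a + 1 + ((a + 1) * (b + 1) - 1) by
          have : 0 < (a + 1) * (b + 1) := by positivity
          rw [Nat.mul_succ (a + 1) (b + 1)]
          omega]) ≪≫
      npowAuxAdd U _ a ≪≫ biprod.mapIso (Iso.refl _) (npowAuxMul U a b)

/-- Splitting off the first factor of a finite power. -/
noncomputable def biprodPiIso (U : C) (n : ℕ) :
    U ⊞ (∏ᶜ fun _ : Fin n => U) ≅ ∏ᶜ fun _ : Fin (n + 1) => U where
  hom := Pi.lift (Fin.cases biprod.fst fun i => biprod.snd ≫ Pi.π (fun _ : Fin n => U) i)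
  inv := biprod.lift (Pi.π (fun _ : Fin (n + 1) => U) 0)
    (Pi.lift fun i => Pi.π (fun _ : Fin (n + 1) => U) i.succ)
  hom_inv_id := by
    apply biprod.hom_ext
    · simp
    · apply Pi.hom_ext
      intro i
      simp
  inv_hom_id := by
    apply Pi.hom_ext
    intro i
    refine Fin.cases ?_ (fun i => ?_) i <;> simp

/-- The iterated biproduct of copies of `U` is a finite product. -/
noncomputable def npowAuxIsoPi (U : C) : ∀ n : ℕ, npowAux C U n ≅ ∏ᶜ fun _ : Fin (n + 1) => U
  | 0 => (productUniqueIso fun _ : Fin 1 => U).symm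
  | n + 1 => biprod.mapIso (Iso.refl U) (npowAuxIsoPi U n) ≪≫ biprodPiIso U (n + 1)

lemma mem_sqrtSet_iff {S : Set C} {U : C} : U ∈ sqrtSet C S ↔ ∃ n : ℕ, npowAux C U n ∈ S :=
  ⟨fun ⟨n, _, h⟩ => ⟨n - 1, h⟩, fun ⟨n, h⟩ => ⟨n + 1, by omega, h⟩⟩

namespace IsTriangulatedSubcat

variable {S : Set C}

lemma biprod_mem (hS : IsTriangulatedSubcat C S) {X Y : C} (hX : X ∈ S) (hY : Y ∈ S) :
    (X ⊞ Y) ∈ S :=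
  hS.ext_mem _ (inv_rot_of_distTriang _ (binaryBiproductTriangle_distinguished X Y))
    (hS.shift_neg_mem hY) hX

lemma npowAux_mem (hS : IsTriangulatedSubcat C S) {X : C} (hX : X ∈ S) :
    ∀ n : ℕ, npowAux C X n ∈ S
  | 0 => hX
  | n + 1 => hS.biprod_mem hX (hS.npowAux_mem hX n)

lemma npowAux_ext_mem (hS : IsTriangulatedSubcat C S) (T : Triangle C)
    (hT : T ∈ distTriang C) (n : ℕ) (h₁ : npowAux C T.obj₁ n ∈ S) (h₂ : npowAux C T.obj₂ n ∈ S) :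
    npowAux C T.obj₃ n ∈ S :=
  hS.mem_of_iso (npowAuxIsoPi T.obj₃ n)
    (hS.ext_mem _ (productTriangle_distinguished (fun _ : Fin (n + 1) => T) fun _ => hT)
      (hS.mem_of_iso (npowAuxIsoPi T.obj₁ n).symm h₁)
      (hS.mem_of_iso (npowAuxIsoPi T.obj₂ n).symm h₂))

lemma npowAux_mul_mem (hS : IsTriangulatedSubcat C S) {U : C} {a : ℕ}
    (h : npowAux C U a ∈ S) (b : ℕ) :
    npowAux C U ((a + 1) * (b + 1) - 1) ∈ S :=
  hS.mem_of_iso (npowAuxMul U a b) (hS.npowAux_mem h b)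

lemma mem_sqrtSet_of_npowAux_mem (hS : IsTriangulatedSubcat C S) {U : C} {n : ℕ}
    (h : npowAux C U n ∈ sqrtSet C S) :
    U ∈ sqrtSet C S := by
  obtain ⟨m, hm⟩ := mem_sqrtSet_iff.1 h
  exact mem_sqrtSet_iff.2 ⟨_, hS.mem_of_iso (npowAuxMul U n m) hm⟩

lemma map_mem_sqrtSet (hS : IsTriangulatedSubcat C S) (F : C ⥤ C) [F.Additive]
    (hF : ∀ {X : C}, X ∈ S → F.obj X ∈ S) {X : C} (hX : X ∈ sqrtSet C S) :
    F.obj X ∈ sqrtSet C S := by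
  obtain ⟨n, hn⟩ := mem_sqrtSet_iff.1 hX
  exact mem_sqrtSet_iff.2 ⟨n, hS.mem_of_iso (npowAuxMap F X n) (hF hn)⟩

lemma sqrtSet_isTriangulated (hS : IsTriangulatedSubcat C S) :
    IsTriangulatedSubcat C (sqrtSet C S) where
  mem_of_iso e hY := by
    obtain ⟨n, hn⟩ := mem_sqrtSet_iff.1 hY
    exact mem_sqrtSet_iff.2 ⟨n, hS.mem_of_iso (npowAuxCongr e n) hn⟩
  shift_mem := hS.map_mem_sqrtSet _ hS.shift_mem
  shift_neg_mem := hS.map_mem_sqrtSet _ hS.shift_neg_mem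
  ext_mem T hT h₁ h₂ := by
    obtain ⟨a, ha⟩ := mem_sqrtSet_iff.1 h₁
    obtain ⟨b, hb⟩ := mem_sqrtSet_iff.1 h₂
    have hb' := hS.npowAux_mul_mem hb a
    rw [mul_comm] at hb'
    exact mem_sqrtSet_iff.2 ⟨_, hS.npowAux_ext_mem T hT _ (hS.npowAux_mul_mem ha b) hb'⟩

end IsTriangulatedSubcat

variable (C)

/-- properties of `√D` for a dense triangulated subcategory `D`. -/
theorem sqrt_of_dense_subcategory (S : Set C) (hS : IsTriangulatedSubcat C S)
    (hdense : DenseSub C S) :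
    S ⊆ sqrtSet C S ∧
    sqrtSet C (sqrtSet C S) = sqrtSet C S ∧
    (IsTriangulatedSubcat C (sqrtSet C S) ∧ DenseSub C (sqrtSet C S) ∧
      RadicalSub C (sqrtSet C S)) ∧
    (RadicalSub C S ↔ sqrtSet C S = S) := by
  have hrad : RadicalSub C (sqrtSet C S) := fun U n _ h => hS.mem_sqrtSet_of_npowAux_mem h
  refine ⟨subset_sqrtSet C S, ?_, ⟨hS.sqrtSet_isTriangulated, ?_, hrad⟩, ?_, fun h => h ▸ hrad⟩
  · exact Set.Subset.antisymm (fun U ⟨n, hn, h⟩ => hrad U n hn h) (subset_sqrtSet C _)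
  · intro U
    obtain ⟨V, hV⟩ := hdense U
    exact ⟨V, subset_sqrtSet C S hV⟩
  · intro h
    exact Set.Subset.antisymm (fun U ⟨n, hn, hU⟩ => h U n hn hU) (subset_sqrtSet C S)


end GrothendieckPaper
end

section
/- Let C be a skeletally small triangulated category and let H be a Q-subspace of G(C)_Q. Then there exists a dense triangulated subcategory D of C such that the image of the injective map δ^D_Q : G(D)_Q → G(C)_Q equals H. -/
open CategoryTheory CategoryTheory.Limits CategoryTheory.Pretriangulated
open scoped TensorProduct

universe v u

set_option linter.unusedSectionVars false
set_option linter.unusedVariables false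

namespace GrothendieckPaper

variable (C : Type u) [Category.{v} C] [Preadditive C] [Limits.HasZeroObject C]
  [HasShift C ℤ] [∀ n : ℤ, (shiftFunctor C n).Additive] [Pretriangulated C]

section

open scoped ZeroObject

variable {C}

lemma cls_add (T : Triangle C) (hT : T ∈ distTriang C) :
    cls C T.obj₂ = cls C T.obj₁ + cls C T.obj₃ := by
  have h : (QuotientAddGroup.mk (FreeAbelianGroup.of T.obj₂ - FreeAbelianGroup.of T.obj₁ -
      FreeAbelianGroup.of T.obj₃) : FreeAbelianGroup C ⧸ eulerSubgroup C) = 0 :=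
    (QuotientAddGroup.eq_zero_iff _).2 (AddSubgroup.subset_closure ⟨T, hT, rfl⟩)
  have h' : cls C T.obj₂ - cls C T.obj₁ - cls C T.obj₃ = 0 := h
  rwa [sub_sub, sub_eq_zero] at h'

lemma cls_zero : cls C (0 : C) = 0 := by
  have h : cls C (0 : C) = cls C (0 : C) + cls C (0 : C) :=
    cls_add _ (contractible_distinguished (0 : C))
  exact left_eq_add.1 h

lemma cls_of_iso {X Y : C} (e : X ≅ Y) : cls C X = cls C Y := by
  have h : cls C Y = cls C X + cls C (0 : C) :=
    cls_add (Triangle.mk e.hom (0 : Y ⟶ 0) 0)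
      (isomorphic_distinguished _ (contractible_distinguished X) _
        (Triangle.isoMk (Triangle.mk e.hom (0 : Y ⟶ 0) 0) (contractibleTriangle X)
          (Iso.refl X) e.symm (Iso.refl 0)
          (show e.hom ≫ e.inv = 𝟙 X ≫ 𝟙 X by simp)
          (show (0 : Y ⟶ 0) ≫ 𝟙 0 = e.inv ≫ 0 by simp)
          ((isZero_zero C).eq_of_src _ _)))
  rw [h, cls_zero, add_zero]

lemma cls_shift_one (X : C) : cls C ((shiftFunctor C (1 : ℤ)).obj X) = -cls C X := by
  have h : cls C (0 : C) = cls C X + cls C ((shiftFunctor C (1 : ℤ)).obj X) :=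
    cls_add _ (rot_of_distTriang _ (contractible_distinguished X))
  rw [cls_zero] at h
  exact (neg_eq_of_add_eq_zero_right h.symm).symm

lemma cls_shift_neg_one (X : C) : cls C ((shiftFunctor C (-1 : ℤ)).obj X) = -cls C X := by
  have h : cls C ((shiftFunctor C (1 : ℤ)).obj ((shiftFunctor C (-1 : ℤ)).obj X)) = cls C X :=
    cls_of_iso ((shiftFunctorCompIsoId C (-1 : ℤ) 1 (by simp)).app X)
  rw [← h, cls_shift_one, neg_neg]

lemma cls_biprod (X Y : C) : cls C (X ⊞ Y) = cls C X + cls C Y :=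
  cls_add _ (binaryBiproductTriangle_distinguished X Y)

lemma cls_surjective : Function.Surjective (cls C) := by
  intro g
  obtain ⟨x, rfl⟩ := QuotientAddGroup.mk_surjective g
  induction x using FreeAbelianGroup.induction_on with
  | zero => exact ⟨0, cls_zero⟩
  | of X => exact ⟨X, rfl⟩
  | neg X _ => exact ⟨_, cls_shift_one X⟩
  | add x y hx hy =>
    obtain ⟨X, hX⟩ := hx
    obtain ⟨Y, hY⟩ := hy
    exact ⟨X ⊞ Y, by rw [cls_biprod, hX, hY]; rfl⟩

lemma exists_smul_eq_one_tmul {M : Type*} [AddCommGroup M] (x : ℚ ⊗[ℤ] M) :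
    ∃ (n : ℤ) (m : M), n ≠ 0 ∧ (n : ℚ) • x = 1 ⊗ₜ[ℤ] m := by
  induction x using TensorProduct.induction_on with
  | zero => exact ⟨1, 0, one_ne_zero, by simp⟩
  | tmul q m =>
    refine ⟨q.den, q.num • m, by simp, ?_⟩
    rw [← TensorProduct.smul_tmul, TensorProduct.smul_tmul']
    congr 1
    simp [Rat.den_mul_eq_num]
  | add x y hx hy =>
    obtain ⟨a, m, ha, hm⟩ := hx
    obtain ⟨b, k, hb, hk⟩ := hy
    refine ⟨a * b, b • m + a • k, mul_ne_zero ha hb, ?_⟩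
    rw [TensorProduct.tmul_add, TensorProduct.tmul_smul, TensorProduct.tmul_smul, ← hm, ← hk,
      ← Int.cast_smul_eq_zsmul ℚ b, ← Int.cast_smul_eq_zsmul ℚ a, smul_smul, smul_smul, smul_add]
    push_cast
    rw [mul_comm (b : ℚ)]

lemma deltaQ_tmul_cls {S : Set C} (q : ℚ) (U : S) :
    deltaQ C S (q ⊗ₜ[ℤ] (QuotientAddGroup.mk (FreeAbelianGroup.of U) : GSub C S)) =
      q ⊗ₜ[ℤ] cls C (U : C) := by
  have h : deltaHom C S (QuotientAddGroup.mk (FreeAbelianGroup.of U) : GSub C S) =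
      cls C (U : C) := by
    change QuotientAddGroup.mk (FreeAbelianGroup.map (Subtype.val : S → C) _) = _
    rw [FreeAbelianGroup.map_of_apply]
    rfl
  rw [← h]
  rfl

/-- The triangulated subcategory of objects whose class lies in a subgroup of `G C`. -/
def subcatOfSubgroup (K : AddSubgroup (G C)) : Set C := {U | cls C U ∈ K}

lemma isTriangulatedSubcat_subcatOfSubgroup (K : AddSubgroup (G C)) :
    IsTriangulatedSubcat C (subcatOfSubgroup K) where
  mem_of_iso e h := by
    change cls C _ ∈ K
    rwa [cls_of_iso e]
  shift_mem h := by
    change cls C _ ∈ K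
    rw [cls_shift_one]
    exact neg_mem h
  shift_neg_mem h := by
    change cls C _ ∈ K
    rw [cls_shift_neg_one]
    exact neg_mem h
  ext_mem T hT h₁ h₂ := by
    change cls C _ ∈ K
    rw [eq_sub_of_add_eq' (cls_add T hT).symm]
    exact sub_mem h₂ h₁

lemma denseSub_subcatOfSubgroup (K : AddSubgroup (G C)) : DenseSub C (subcatOfSubgroup K) := by
  refine fun U => ⟨(shiftFunctor C (1 : ℤ)).obj U, ?_⟩
  change cls C _ ∈ K
  rw [cls_biprod, cls_shift_one, add_neg_cancel]
  exact zero_mem K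

lemma range_deltaQ_le_iff (S : Set C) (H : Submodule ℚ (ℚ ⊗[ℤ] G C)) :
    LinearMap.range (deltaQ C S) ≤ H ↔ ∀ U ∈ S, (1 : ℚ) ⊗ₜ[ℤ] cls C U ∈ H := by
  refine ⟨fun h U hU => h ⟨_, deltaQ_tmul_cls 1 ⟨U, hU⟩⟩, fun h => ?_⟩
  rintro _ ⟨x, rfl⟩
  induction x using TensorProduct.induction_on with
  | zero => simp
  | add x y hx hy => rw [map_add]; exact add_mem hx hy
  | tmul q g =>
    obtain ⟨x, rfl⟩ := QuotientAddGroup.mk_surjective g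
    induction x using FreeAbelianGroup.induction_on with
    | zero =>
      rw [QuotientAddGroup.mk_zero]
      erw [TensorProduct.tmul_zero]
      simp
    | of U =>
      erw [deltaQ_tmul_cls]
      simpa [TensorProduct.smul_tmul'] using H.smul_mem q (h U U.2)
    | neg U ih =>
      rw [QuotientAddGroup.mk_neg]
      erw [TensorProduct.tmul_neg]
      rw [map_neg]
      exact neg_mem ih
    | add x y hx hy =>
      rw [QuotientAddGroup.mk_add]
      erw [TensorProduct.tmul_add]
      rw [map_add]
      exact add_mem hx hy

end

/-- every `ℚ`-subspace of `G(C)_ℚ` is the image of `δ^D_ℚ` for some dense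
triangulated subcategory `D` of `C`. -/
theorem exists_dense_subcategory_of_subspace (H : Submodule ℚ (ℚ ⊗[ℤ] G C)) :
    ∃ S : Set C, IsTriangulatedSubcat C S ∧ DenseSub C S ∧
      LinearMap.range (deltaQ C S) = H := by
  let K : AddSubgroup (G C) :=
    H.toAddSubgroup.comap (TensorProduct.mk ℤ ℚ (G C) 1).toAddMonoidHom
  refine ⟨subcatOfSubgroup K, isTriangulatedSubcat_subcatOfSubgroup K,
    denseSub_subcatOfSubgroup K,
    le_antisymm ((range_deltaQ_le_iff _ _).2 fun U hU => hU) fun x hx => ?_⟩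
  obtain ⟨n, g, hn, hg⟩ := exists_smul_eq_one_tmul x
  obtain ⟨U, rfl⟩ := cls_surjective g
  have hU : (1 : ℚ) ⊗ₜ[ℤ] cls C U ∈ H := hg ▸ H.smul_mem _ hx
  rw [← Submodule.smul_mem_iff _ (Int.cast_ne_zero.2 hn : (n : ℚ) ≠ 0), hg]
  exact ⟨_, deltaQ_tmul_cls 1 ⟨U, hU⟩⟩


end GrothendieckPaper
end

section
/- Let C be a skeletally small triangulated category and let D be a dense triangulated subcategory of C. Let √D = { U ∈ C | U^n ∈ D for some n ≥ 1 }. Then the natural map G(D)_Q → G(√D)_Q induced by the inclusion D ⊆ √D is an isomorphism. Consequently, the images of δ^D_Q and δ^{√D}_Q in G(C)_Q coincide. -/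
open CategoryTheory CategoryTheory.Limits CategoryTheory.Pretriangulated
open scoped TensorProduct

universe v u

set_option linter.unusedSectionVars false
set_option linter.unusedVariables false

namespace GrothendieckPaper

variable (C : Type u) [Category.{v} C] [Preadditive C] [Limits.HasZeroObject C]
  [HasShift C ℤ] [∀ n : ℤ, (shiftFunctor C n).Additive] [Pretriangulated C]

open scoped ZeroObject

variable {C}

/-- The class of an object of `S` in the Grothendieck group `GSub C S`. -/
def clsSub (S : Set C) (U : C) (hU : U ∈ S) : GSub C S :=
  QuotientAddGroup.mk (FreeAbelianGroup.of ⟨U, hU⟩)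

lemma clsSub_obj₂ {S : Set C} {T : Triangle C} (hT : T ∈ distTriang C)
    (h1 : T.obj₁ ∈ S) (h2 : T.obj₂ ∈ S) (h3 : T.obj₃ ∈ S) :
    clsSub S T.obj₂ h2 = clsSub S T.obj₁ h1 + clsSub S T.obj₃ h3 := by
  have h : (QuotientAddGroup.mk (FreeAbelianGroup.of (⟨T.obj₂, h2⟩ : S)
      - FreeAbelianGroup.of ⟨T.obj₁, h1⟩ - FreeAbelianGroup.of ⟨T.obj₃, h3⟩) : GSub C S) = 0 :=
    (QuotientAddGroup.eq_zero_iff _).2 (AddSubgroup.subset_closure ⟨T, hT, h1, h2, h3, rfl⟩)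
  have h' : clsSub S T.obj₂ h2 - clsSub S T.obj₁ h1 - clsSub S T.obj₃ h3 = 0 := h
  rw [sub_sub, sub_eq_zero] at h'
  exact h'

lemma inclHom_clsSub {S S' : Set C} (h : S ⊆ S') (U : C) (hU : U ∈ S) :
    inclHom C h (clsSub S U hU) = clsSub S' U (h hU) := by
  change (QuotientAddGroup.mk (FreeAbelianGroup.map (Set.inclusion h) (FreeAbelianGroup.of ⟨U, hU⟩))
    : GSub C S') = _
  rw [FreeAbelianGroup.map_of_apply]
  rfl

lemma deltaHom_clsSub (S : Set C) (U : C) (hU : U ∈ S) :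
    deltaHom C S (clsSub S U hU) = cls C U := by
  change (QuotientAddGroup.mk (FreeAbelianGroup.map (Subtype.val : S → C)
    (FreeAbelianGroup.of ⟨U, hU⟩)) : G C) = _
  rw [FreeAbelianGroup.map_of_apply]
  rfl

/-- Two additive maps out of `GSub C S` agree if they agree on classes of objects. -/
lemma GSub.addHom_ext {S : Set C} {A : Type*} [AddCommGroup A] {f g : GSub C S →+ A}
    (h : ∀ U hU, f (clsSub S U hU) = g (clsSub S U hU)) : f = g := by
  have : f.comp (QuotientAddGroup.mk' (AddSubgroup.closure (eulerSetSub C S))) =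
      g.comp (QuotientAddGroup.mk' (AddSubgroup.closure (eulerSetSub C S))) :=
    FreeAbelianGroup.lift_ext _ _ fun x => h x.1 x.2
  ext x
  obtain ⟨y, rfl⟩ := QuotientAddGroup.mk'_surjective _ x
  exact DFunLike.congr_fun this y

/-- A set of objects closed under isomorphisms, containing zero objects and closed under
binary direct sums. -/
structure AddClosed (S : Set C) : Prop where
  mem_of_iso : ∀ {X Y : C}, (X ≅ Y) → Y ∈ S → X ∈ S
  zero_mem : ∀ {X : C}, IsZero X → X ∈ S
  biprod_mem : ∀ {X Y : C}, X ∈ S → Y ∈ S → (X ⊞ Y) ∈ S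

lemma clsSub_zero {S : Set C} {Z : C} (hZ : IsZero Z) (h : Z ∈ S) : clsSub S Z h = 0 := by
  have h1 := clsSub_obj₂ (T := Triangle.mk (𝟙 Z) (0 : Z ⟶ Z) 0)
    (by
      refine isomorphic_distinguished _ (contractible_distinguished Z) _
        (Triangle.isoMk _ _ (Iso.refl _) (Iso.refl _) (hZ.iso (isZero_zero C)) ?_ ?_ ?_)
      · exact hZ.eq_of_src _ _
      · exact (isZero_zero C).eq_of_tgt _ _
      · exact hZ.eq_of_src _ _) h h h
  simpa using h1

lemma AddClosed.clsSub_iso {S : Set C} (hS : AddClosed S) {X Y : C} (e : X ≅ Y)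
    (hX : X ∈ S) (hY : Y ∈ S) : clsSub S X hX = clsSub S Y hY := by
  have h0 : (0 : C) ∈ S := hS.zero_mem (isZero_zero C)
  have h1 := clsSub_obj₂ (T := Triangle.mk e.hom (0 : Y ⟶ 0) 0)
    (isomorphic_distinguished _ (contractible_distinguished Y) _
        (Triangle.isoMk _ _ e (Iso.refl _) (Iso.refl _)
          ((Category.comp_id _).trans (Category.comp_id _).symm)
          ((isZero_zero C).eq_of_tgt _ _) ((isZero_zero C).eq_of_src _ _))) hX hY h0
  have h2 := clsSub_zero (isZero_zero C) h0
  change clsSub S Y hY = clsSub S X hX + clsSub S 0 h0 at h1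
  rw [h1, h2, add_zero]

lemma clsSub_biprod {S : Set C} {X Y : C} (hX : X ∈ S) (hY : Y ∈ S) (h : (X ⊞ Y) ∈ S) :
    clsSub S (X ⊞ Y) h = clsSub S X hX + clsSub S Y hY :=
  clsSub_obj₂ (binaryBiproductTriangle_distinguished X Y) hX h hY

lemma npow_succ (U : C) {n : ℕ} (hn : 1 ≤ n) : npow C U (n + 1) = (U ⊞ npow C U n) := by
  obtain ⟨m, rfl⟩ : ∃ m, n = m + 1 := ⟨n - 1, by omega⟩
  rfl

/-- `U ^ a ⊞ U ^ b ≅ U ^ (a + b)`. -/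
lemma npow_add_iso (U : C) {a b : ℕ} (ha : 1 ≤ a) (hb : 1 ≤ b) :
    Nonempty ((npow C U a ⊞ npow C U b) ≅ npow C U (a + b)) := by
  induction a, ha using Nat.le_induction with
  | base => rw [add_comm, npow_succ U hb]; exact ⟨Iso.refl _⟩
  | succ a ha ih =>
    obtain ⟨e⟩ := ih
    rw [show a + 1 + b = a + b + 1 by omega, npow_succ U ha, npow_succ U (by omega)]
    exact ⟨biprod.associator _ _ _ ≪≫ biprod.mapIso (Iso.refl _) e⟩

lemma npow_map_iso {U V : C} (e : U ≅ V) {n : ℕ} (hn : 1 ≤ n) :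
    Nonempty (npow C U n ≅ npow C V n) := by
  induction n, hn using Nat.le_induction with
  | base => exact ⟨e⟩
  | succ n hn ih =>
    obtain ⟨e'⟩ := ih
    rw [npow_succ U hn, npow_succ V hn]
    exact ⟨biprod.mapIso e e'⟩

/-- `U ^ n` is the categorical product of `n` copies of `U`. -/
lemma pi_iso_npow (U : C) {n : ℕ} (hn : 1 ≤ n) :
    Nonempty ((∏ᶜ fun _ : Fin n => U) ≅ npow C U n) := by
  induction n, hn using Nat.le_induction with
  | base => exact ⟨productUniqueIso _⟩
  | succ n hn ih =>
    obtain ⟨e⟩ := ih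
    rw [npow_succ U hn]
    let l := extendFanIsLimit (fun _ : Fin (n + 1) => U)
      (limit.isLimit (Discrete.functor fun _ : Fin n => U))
      (limit.isLimit (pair U (∏ᶜ fun _ : Fin n => U)))
    exact ⟨(limit.isLimit _).conePointUniqueUpToIso l ≪≫
      (biprod.isoProd U (∏ᶜ fun _ : Fin n => U)).symm ≪≫ biprod.mapIso (Iso.refl _) e⟩

/-- The direct sum of `n` copies of a distinguished triangle. -/
lemma exists_npow_triangle {T : Triangle C} (hT : T ∈ distTriang C) {n : ℕ} (hn : 1 ≤ n) :
    ∃ T' : Triangle C, T' ∈ distTriang C ∧ Nonempty (T'.obj₁ ≅ npow C T.obj₁ n) ∧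
      Nonempty (T'.obj₂ ≅ npow C T.obj₂ n) ∧ Nonempty (T'.obj₃ ≅ npow C T.obj₃ n) :=
  ⟨productTriangle fun _ : Fin n => T, productTriangle_distinguished _ fun _ => hT,
    pi_iso_npow _ hn, pi_iso_npow _ hn, pi_iso_npow _ hn⟩

namespace IsTriangulatedSubcat

variable {S : Set C}

lemma obj₂_mem (hS : IsTriangulatedSubcat C S) {T : Triangle C} (hT : T ∈ distTriang C)
    (h1 : T.obj₁ ∈ S) (h3 : T.obj₃ ∈ S) : T.obj₂ ∈ S :=
  hS.ext_mem T.invRotate (inv_rot_of_distTriang T hT) (hS.shift_neg_mem h3) h1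

lemma addClosed (hS : IsTriangulatedSubcat C S) (hne : S.Nonempty) : AddClosed S where
  mem_of_iso := hS.mem_of_iso
  zero_mem hX := by
    obtain ⟨U, hU⟩ := hne
    exact hS.mem_of_iso (hX.iso (isZero_zero C))
      (hS.ext_mem _ (contractible_distinguished U) hU hU)
  biprod_mem hX hY := hS.obj₂_mem (binaryBiproductTriangle_distinguished _ _) hX hY

end IsTriangulatedSubcat

namespace AddClosed

variable {S : Set C}

lemma npow_mul_mem (hS : AddClosed S) {U : C} {n k : ℕ} (hn : 1 ≤ n) (hk : 1 ≤ k)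
    (h : npow C U n ∈ S) : npow C U (k * n) ∈ S := by
  induction k, hk using Nat.le_induction with
  | base => rwa [one_mul]
  | succ k hk ih =>
    obtain ⟨e⟩ := npow_add_iso U (Nat.mul_pos hk hn) hn
    rw [Nat.succ_mul]
    exact hS.mem_of_iso e.symm (hS.biprod_mem ih h)

lemma clsSub_npow_mul (hS : AddClosed S) {U : C} {n k : ℕ} (hn : 1 ≤ n) (hk : 1 ≤ k)
    (h : npow C U n ∈ S) (h' : npow C U (k * n) ∈ S) :
    clsSub S _ h' = (k : ℤ) • clsSub S _ h := by
  induction k, hk using Nat.le_induction with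
  | base => simp
  | succ k hk ih =>
    obtain ⟨e⟩ := npow_add_iso U (Nat.mul_pos hk hn) hn
    have hkn := hS.npow_mul_mem hn hk h
    rw [← Nat.succ_mul] at e
    rw [← hS.clsSub_iso e (hS.biprod_mem hkn h) h', clsSub_biprod hkn h, ih hkn]
    push_cast
    rw [add_smul, one_smul]

end AddClosed

lemma IsTriangulatedSubcat.sqrt_addClosed {S : Set C}
    (hS : IsTriangulatedSubcat C S) (hne : S.Nonempty) : AddClosed (sqrtSet C S) where
  mem_of_iso e := by
    rintro ⟨n, hn, h⟩
    obtain ⟨e'⟩ := npow_map_iso e hn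
    exact ⟨n, hn, hS.mem_of_iso e' h⟩
  zero_mem hX := subset_sqrtSet C S ((hS.addClosed hne).zero_mem hX)
  biprod_mem := by
    rintro X Y ⟨n, hn, hX⟩ ⟨m, hm, hY⟩
    have hA := hS.addClosed hne
    obtain ⟨T, hT, ⟨e₁⟩, ⟨e₂⟩, ⟨e₃⟩⟩ := exists_npow_triangle
      (binaryBiproductTriangle_distinguished X Y) (Nat.mul_pos hm hn)
    refine ⟨m * n, Nat.mul_pos hm hn, hS.mem_of_iso e₂.symm (hS.obj₂_mem hT ?_ ?_)⟩
    · exact hS.mem_of_iso e₁ (hA.npow_mul_mem hn hm hX)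
    · refine hS.mem_of_iso e₃ ?_
      rw [mul_comm]
      exact hA.npow_mul_mem hm hn hY

namespace AddClosed

variable {S : Set C}

lemma inv_tmul_clsSub_npow_mul (hS : AddClosed S) {U : C} {n k : ℕ} (hn : 1 ≤ n) (hk : 1 ≤ k)
    (h : npow C U n ∈ S) (h' : npow C U (k * n) ∈ S) :
    ((((k * n : ℕ) : ℚ)⁻¹) ⊗ₜ[ℤ] clsSub S _ h' : ℚ ⊗[ℤ] GSub C S) =
      ((n : ℚ)⁻¹) ⊗ₜ[ℤ] clsSub S _ h := by
  rw [hS.clsSub_npow_mul hn hk h h', ← TensorProduct.smul_tmul]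
  congr 1
  have : (k : ℚ) ≠ 0 := by positivity
  have : (n : ℚ) ≠ 0 := by positivity
  rw [zsmul_eq_mul]
  push_cast
  field_simp

lemma inv_tmul_clsSub_npow_eq (hS : AddClosed S) {U : C} {n m : ℕ} (hn : 1 ≤ n) (hm : 1 ≤ m)
    (h : npow C U n ∈ S) (h' : npow C U m ∈ S) :
    (((n : ℚ)⁻¹) ⊗ₜ[ℤ] clsSub S _ h : ℚ ⊗[ℤ] GSub C S) = ((m : ℚ)⁻¹) ⊗ₜ[ℤ] clsSub S _ h' := by
  rw [← hS.inv_tmul_clsSub_npow_mul hn hm h (hS.npow_mul_mem hn hm h),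
    ← hS.inv_tmul_clsSub_npow_mul hm hn h' (hS.npow_mul_mem hm hn h')]
  simp only [mul_comm n m]

end AddClosed

/-- The class `n⁻¹ • [U ^ n]` attached to an object `U` of `√S`. -/
noncomputable def sqrtClass (S : Set C) (U : sqrtSet C S) : ℚ ⊗[ℤ] GSub C S :=
  ((U.2.choose : ℚ)⁻¹) ⊗ₜ[ℤ] clsSub S _ U.2.choose_spec.2

lemma AddClosed.sqrtClass_eq {S : Set C} (hS : AddClosed S) (U : sqrtSet C S) {n : ℕ}
    (hn : 1 ≤ n) (h : npow C U n ∈ S) :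
    sqrtClass S U = ((n : ℚ)⁻¹) ⊗ₜ[ℤ] clsSub S _ h :=
  hS.inv_tmul_clsSub_npow_eq U.2.choose_spec.1 hn _ _

lemma AddClosed.sqrtClass_obj₂ {S : Set C} (hS : AddClosed S) {T : Triangle C}
    (hT : T ∈ distTriang C) (h1 : T.obj₁ ∈ sqrtSet C S) (h2 : T.obj₂ ∈ sqrtSet C S)
    (h3 : T.obj₃ ∈ sqrtSet C S) :
    sqrtClass S ⟨T.obj₂, h2⟩ = sqrtClass S ⟨T.obj₁, h1⟩ + sqrtClass S ⟨T.obj₃, h3⟩ := by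
  obtain ⟨a, ha, h1'⟩ := id h1
  obtain ⟨b, hb, h2'⟩ := id h2
  obtain ⟨c, hc, h3'⟩ := id h3
  have hn : 1 ≤ a * b * c := Nat.mul_pos (Nat.mul_pos ha hb) hc
  have k1 : npow C T.obj₁ (a * b * c) ∈ S := by
    rw [show a * b * c = b * c * a by ring]
    exact hS.npow_mul_mem ha (Nat.mul_pos hb hc) h1'
  have k2 : npow C T.obj₂ (a * b * c) ∈ S := by
    rw [show a * b * c = a * c * b by ring]
    exact hS.npow_mul_mem hb (Nat.mul_pos ha hc) h2'
  have k3 : npow C T.obj₃ (a * b * c) ∈ S := hS.npow_mul_mem hc (Nat.mul_pos ha hb) h3'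
  obtain ⟨T', hT', ⟨e₁⟩, ⟨e₂⟩, ⟨e₃⟩⟩ := exists_npow_triangle hT hn
  rw [hS.sqrtClass_eq ⟨_, h1⟩ hn k1, hS.sqrtClass_eq ⟨_, h2⟩ hn k2, hS.sqrtClass_eq ⟨_, h3⟩ hn k3,
    ← TensorProduct.tmul_add, ← hS.clsSub_iso e₁ (hS.mem_of_iso e₁ k1) k1,
    ← hS.clsSub_iso e₂ (hS.mem_of_iso e₂ k2) k2, ← hS.clsSub_iso e₃ (hS.mem_of_iso e₃ k3) k3,
    clsSub_obj₂ hT' (hS.mem_of_iso e₁ k1) (hS.mem_of_iso e₂ k2) (hS.mem_of_iso e₃ k3)]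

/-- The map `G(√S) → G(S)_ℚ` sending `[U]` to `n⁻¹ • [U ^ n]`. -/
noncomputable def AddClosed.sqrtHom {S : Set C} (hS : AddClosed S) :
    GSub C (sqrtSet C S) →+ ℚ ⊗[ℤ] GSub C S :=
  QuotientAddGroup.lift _ (FreeAbelianGroup.lift (sqrtClass S)) (by
    rw [AddSubgroup.closure_le]
    rintro x ⟨T, hT, h1, h2, h3, rfl⟩
    simp only [SetLike.mem_coe, AddMonoidHom.mem_ker, map_sub, FreeAbelianGroup.lift_apply_of]
    rw [hS.sqrtClass_obj₂ hT h1 h2 h3]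
    abel)

lemma AddClosed.sqrtHom_clsSub {S : Set C} (hS : AddClosed S) (U : C) (hU : U ∈ sqrtSet C S) :
    hS.sqrtHom (clsSub _ U hU) = sqrtClass S ⟨U, hU⟩ :=
  FreeAbelianGroup.lift_apply_of _ _

lemma inclQ_tmul {S S' : Set C} (h : S ⊆ S') (q : ℚ) (x : GSub C S) :
    inclQ C h (q ⊗ₜ x) = q ⊗ₜ inclHom C h x :=
  LinearMap.baseChange_tmul _ _ _

lemma AddClosed.liftBaseChange_sqrtHom_inclQ {S : Set C} (hS : AddClosed S)
    (x : ℚ ⊗[ℤ] GSub C S) :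
    LinearMap.liftBaseChange ℚ hS.sqrtHom.toIntLinearMap
      (inclQ C (subset_sqrtSet C S) x) = x := by
  have key : hS.sqrtHom.comp (inclHom C (subset_sqrtSet C S)) =
      (TensorProduct.mk ℤ ℚ (GSub C S) 1).toAddMonoidHom := by
    refine GSub.addHom_ext fun U hU => ?_
    rw [AddMonoidHom.comp_apply, inclHom_clsSub, hS.sqrtHom_clsSub,
      hS.sqrtClass_eq ⟨U, subset_sqrtSet C S hU⟩ le_rfl hU]
    simp
    rfl
  induction x with
  | zero => simp
  | add x y hx hy => rw [map_add, map_add, hx, hy]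
  | tmul q x =>
    rw [inclQ_tmul, LinearMap.liftBaseChange_tmul]
    have := DFunLike.congr_fun key x
    change q • (hS.sqrtHom.comp (inclHom C (subset_sqrtSet C S))) x = _
    rw [this]
    change q • ((1 : ℚ) ⊗ₜ[ℤ] x) = _
    rw [TensorProduct.smul_tmul', smul_eq_mul, mul_one]

lemma inclQ_sqrtClass {S : Set C} (hS' : AddClosed (sqrtSet C S)) (U : sqrtSet C S) :
    inclQ C (subset_sqrtSet C S) (sqrtClass S U) = (1 : ℚ) ⊗ₜ clsSub _ U.1 U.2 := by
  rw [sqrtClass, inclQ_tmul, inclHom_clsSub,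
    hS'.inv_tmul_clsSub_npow_eq (m := 1) U.2.choose_spec.1 le_rfl _ U.2]
  simp
  rfl

lemma inclQ_sqrt_surjective {S : Set C} (hS : AddClosed S) (hS' : AddClosed (sqrtSet C S)) :
    Function.Surjective (inclQ C (subset_sqrtSet C S)) := by
  have key : (inclQ C (subset_sqrtSet C S)).toAddMonoidHom.comp hS.sqrtHom =
      (TensorProduct.mk ℤ ℚ (GSub C (sqrtSet C S)) 1).toAddMonoidHom := by
    refine GSub.addHom_ext fun U hU => ?_
    rw [AddMonoidHom.comp_apply, hS.sqrtHom_clsSub]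
    exact inclQ_sqrtClass hS' ⟨U, hU⟩
  intro x
  induction x with
  | zero => exact ⟨0, map_zero _⟩
  | add x y hx hy =>
    obtain ⟨a, rfl⟩ := hx
    obtain ⟨b, rfl⟩ := hy
    exact ⟨a + b, map_add _ _ _⟩
  | tmul q x =>
    refine ⟨q • hS.sqrtHom x, ?_⟩
    have h : inclQ C (subset_sqrtSet C S) (hS.sqrtHom x) = (1 : ℚ) ⊗ₜ[ℤ] x :=
      DFunLike.congr_fun key x
    rw [map_smul, h, TensorProduct.smul_tmul', smul_eq_mul, mul_one]

lemma deltaQ_comp_inclQ {S S' : Set C} (h : S ⊆ S') :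
    (deltaQ C S').comp (inclQ C h) = deltaQ C S := by
  have key : (deltaHom C S').comp (inclHom C h) = deltaHom C S :=
    GSub.addHom_ext fun U hU => by
      rw [AddMonoidHom.comp_apply, inclHom_clsSub, deltaHom_clsSub, deltaHom_clsSub]
  unfold deltaQ inclQ
  rw [← LinearMap.baseChange_comp, ← key]
  rfl

variable (C)

/-- the natural map `G(D)_ℚ → G(√D)_ℚ` is an isomorphism, and consequently
the images of `δ^D_ℚ` and `δ^{√D}_ℚ` in `G(C)_ℚ` coincide. -/
theorem inclQ_sqrt_bijective (S : Set C) (hS : IsTriangulatedSubcat C S)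
    (hdense : DenseSub C S) :
    Function.Bijective (inclQ C (subset_sqrtSet C S)) ∧
    LinearMap.range (deltaQ C S) = LinearMap.range (deltaQ C (sqrtSet C S)) := by
  obtain ⟨V, hV⟩ := hdense 0
  have hA := hS.addClosed ⟨_, hV⟩
  have hsurj := inclQ_sqrt_surjective hA (hS.sqrt_addClosed ⟨_, hV⟩)
  refine ⟨⟨Function.LeftInverse.injective hA.liftBaseChange_sqrtHom_inclQ, hsurj⟩, ?_⟩
  rw [← deltaQ_comp_inclQ (subset_sqrtSet C S), LinearMap.range_comp,
    LinearMap.range_eq_top.2 hsurj, Submodule.map_top]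


end GrothendieckPaper
end
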